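/- arXiv:1009.6054 — 3 statements merged into one kernel-verified Lean document; each statement's English description precedes it below -/
import Mathlib

section
/- (Theorem 2, coordinate form.) C^∞ fields u^α_I : ℝⁿ → ℝ (α ≤ m, |I| ≤ k) and p_α^{I,i} : ℝⁿ → ℝ (α ≤ m, |I| ≤ k−1, 1 ≤ i ≤ n) satisfy the Euler–Lagrange equations of the extended first-order Lagrangian L₁ (i.e., all Euler–Lagrange expressions of L₁ vanish identically) if and only if they satisfy the Euler–Lagrange–Hamilton system of the k-th order Lagrangian L, namely, for all x ∈ ℝⁿ and all α: (i) ∂_i u^α_I(x) = u^α_{I+e_i}(x) for all |I| ≤ k−1 and all i; (ii) Σ_{i=1}^n ∂_i p_α^{I,i}(x) = (∂L/∂u^α_I)(x, u(x)) − Σ_{j : I_j ≥ 1} p_α^{I−e_j, j}(x) for all |I| ≤ k−1; (iii) Σ_{j : I_j ≥ 1} p_α^{I−e_j, j}(x) = (∂L/∂u^α_I)(x, u(x)) for all |I| = k. -/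
/-- Multi-indices of order ≤ k (jet coordinates of order ≤ k). -/
abbrev Adx (n k : ℕ) := {I : Fin n → ℕ // (∑ j, I j) ≤ k}

/-- Multi-indices of order ≤ k−1. -/
abbrev Bdx (n k : ℕ) := {I : Fin n → ℕ // (∑ j, I j) + 1 ≤ k}

noncomputable instance {n k : ℕ} : Fintype (Adx n k) :=
  Fintype.ofInjective
    (fun I : Adx n k => (fun j => (⟨I.1 j, by
        have h1 : I.1 j ≤ ∑ l, I.1 l :=
          Finset.single_le_sum (fun a _ => Nat.zero_le _) (Finset.mem_univ j)
        have h2 := I.2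
        omega⟩ : Fin (k + 1))))
    (fun I J h => Subtype.ext (funext fun j => congrArg Fin.val (congrFun h j)))

noncomputable instance {n k : ℕ} : Fintype (Bdx n k) :=
  Fintype.ofInjective
    (fun I : Bdx n k => (fun j => (⟨I.1 j, by
        have h1 : I.1 j ≤ ∑ l, I.1 l :=
          Finset.single_le_sum (fun a _ => Nat.zero_le _) (Finset.mem_univ j)
        have h2 := I.2
        omega⟩ : Fin (k + 1))))
    (fun I J h => Subtype.ext (funext fun j => congrArg Fin.val (congrFun h j)))

/-- Inclusion of multi-indices of order ≤ k−1 into those of order ≤ k. -/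
def inclA {n k : ℕ} (I : Bdx n k) : Adx n k := ⟨I.1, Nat.le_of_succ_le I.2⟩

/-- The multi-index I + e_i, for |I| ≤ k−1 (so that |I + e_i| ≤ k). -/
def succA {n k : ℕ} (I : Bdx n k) (i : Fin n) : Adx n k :=
  ⟨fun l => I.1 l + (Pi.single i 1 : Fin n → ℕ) l, by
    show (∑ l, (I.1 l + (Pi.single i 1 : Fin n → ℕ) l)) ≤ k
    have h1 : (∑ l, (I.1 l + (Pi.single i 1 : Fin n → ℕ) l)) = (∑ l, I.1 l) + 1 := by
      simp [Finset.sum_add_distrib, Finset.sum_pi_single']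
    have h2 := I.2
    omega⟩

/-- The multi-index I − e_j, defined for |I| ≤ k with I_j ≥ 1 (so |I − e_j| ≤ k−1). -/
def predB {n k : ℕ} (I : Adx n k) (j : Fin n) (h : 1 ≤ I.1 j) : Bdx n k :=
  ⟨fun l => I.1 l - (Pi.single j 1 : Fin n → ℕ) l, by
    show (∑ l, (I.1 l - (Pi.single j 1 : Fin n → ℕ) l)) + 1 ≤ k
    have hle : ∀ l, (Pi.single j 1 : Fin n → ℕ) l ≤ I.1 l := by
      intro l
      by_cases hl : l = j
      · subst hl; simpa using h
      · simp [Pi.single_eq_of_ne hl]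
    have h1 : (∑ l, (I.1 l - (Pi.single j 1 : Fin n → ℕ) l))
        + (∑ l, (Pi.single j 1 : Fin n → ℕ) l) = ∑ l, I.1 l := by
      rw [← Finset.sum_add_distrib]
      exact Finset.sum_congr rfl fun l _ => Nat.sub_add_cancel (hle l)
    have h2 : (∑ l, (Pi.single j 1 : Fin n → ℕ) l) = 1 := by
      simp [Finset.sum_pi_single']
    have h3 := I.2
    omega⟩

/-- The partial derivative ∂_i of a function `f : ℝⁿ → ℝ`. -/
noncomputable def pd {n : ℕ} (i : Fin n) (f : (Fin n → ℝ) → ℝ) : (Fin n → ℝ) → ℝ :=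
  fun x => fderiv ℝ f x (Pi.single i 1)

/-- The Euler–Lagrange expression `EL_a[ℒ; q](x)` of a first-order Lagrangian
`ℒ(x, q, v)` (fields indexed by a finite set `S`), evaluated on fields `q`:
`(∂ℒ/∂q_a)(x, q(x), Dq(x)) − Σ_i ∂_i [(∂ℒ/∂v_{a,i})(·, q(·), Dq(·))](x)`. -/
noncomputable def EL {n : ℕ} {S : Type} [DecidableEq S] [Fintype S]
    (ℒ : (Fin n → ℝ) → (S → ℝ) → (S → Fin n → ℝ) → ℝ)
    (q : S → (Fin n → ℝ) → ℝ) (a : S) (x : Fin n → ℝ) : ℝ :=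
  fderiv ℝ (fun w : S → ℝ => ℒ x w (fun b i => pd i (q b) x)) (fun b => q b x) (Pi.single a 1)
    - ∑ i, pd i (fun y =>
        fderiv ℝ (fun v : S → Fin n → ℝ => ℒ y (fun b => q b y) v)
          (fun b j => pd j (q b) y) (Pi.single a (Pi.single i 1))) x

/-- Index set for the fields of the extended first-order theory:
the fields u^α_I (|I| ≤ k) and the multi-momenta p_α^{I,i} (|I| ≤ k−1). -/
abbrev Sidx (n m k : ℕ) := (Fin m × Adx n k) ⊕ (Fin m × Bdx n k × Fin n)

/-- The extended first-order Lagrangian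
`L₁ = L(x,u) + Σ_{α,|I|≤k−1,i} p_α^{I,i} (u̇^α_{I,i} − u^α_{I+e_i})`. -/
noncomputable def LExt {n m k : ℕ} (L : (Fin n → ℝ) → (Fin m → Adx n k → ℝ) → ℝ) :
    (Fin n → ℝ) → (Sidx n m k → ℝ) → (Sidx n m k → Fin n → ℝ) → ℝ :=
  fun x q v =>
    L x (fun α I => q (Sum.inl (α, I))) +
      ∑ α : Fin m, ∑ I : Bdx n k, ∑ i : Fin n,
        q (Sum.inr (α, I, i)) * (v (Sum.inl (α, inclA I)) i - q (Sum.inl (α, succA I i)))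

/-- The joint field `(u, p)` of the extended first-order theory. -/
def jointFields {n m k : ℕ} (u : Fin m → Adx n k → (Fin n → ℝ) → ℝ)
    (p : Fin m → Bdx n k → Fin n → (Fin n → ℝ) → ℝ) : Sidx n m k → (Fin n → ℝ) → ℝ :=
  fun a => match a with
    | Sum.inl (α, I) => u α I
    | Sum.inr (α, I, i) => p α I i

/-- The partial derivative ∂L/∂u^α_I of a k-th order Lagrangian density
coefficient `L(x, u)`, evaluated at `(x, w)`. -/
noncomputable def dLdu {n m k : ℕ} (L : (Fin n → ℝ) → (Fin m → Adx n k → ℝ) → ℝ)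
    (α : Fin m) (I : Adx n k) (x : Fin n → ℝ) (w : Fin m → Adx n k → ℝ) : ℝ :=
  fderiv ℝ (L x) w (Pi.single α (Pi.single I 1))

/-!
STATEMENT 5 (Theorem 2 of the paper, coordinate form): fields (u, p) satisfy
the Euler–Lagrange equations of the extended first-order Lagrangian L₁ iff
they satisfy the Euler–Lagrange–Hamilton system of the k-th order Lagrangian L.
-/

theorem aux_fderiv_w {n m k : ℕ} (L : (Fin n → ℝ) → (Fin m → Adx n k → ℝ) → ℝ)
    (x : Fin n → ℝ) (hL : Differentiable ℝ (L x))
    (w d : Sidx n m k → ℝ) (V : Sidx n m k → Fin n → ℝ) :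
    fderiv ℝ (fun w => LExt L x w V) w d
      = fderiv ℝ (L x) (fun α I => w (Sum.inl (α, I))) (fun α I => d (Sum.inl (α, I)))
        + ∑ α : Fin m, ∑ I : Bdx n k, ∑ i : Fin n,
          (d (Sum.inr (α, I, i)) * (V (Sum.inl (α, inclA I)) i - w (Sum.inl (α, succA I i)))
            - w (Sum.inr (α, I, i)) * d (Sum.inl (α, succA I i))) := by
  let P : (Sidx n m k → ℝ) →L[ℝ] (Fin m → Adx n k → ℝ) :=
    ContinuousLinearMap.pi fun α => ContinuousLinearMap.pi fun I =>
      ContinuousLinearMap.proj (Sum.inl (α, I))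
  have h1 : HasFDerivAt (fun w : Sidx n m k → ℝ => L x (fun α I => w (Sum.inl (α, I))))
      ((fderiv ℝ (L x) (P w)).comp P) w :=
    ((hL (P w)).hasFDerivAt).comp w P.hasFDerivAt
  have h2 : ∀ (α : Fin m) (I : Bdx n k) (i : Fin n), HasFDerivAt (fun w : Sidx n m k → ℝ =>
      w (Sum.inr (α, I, i)) * (V (Sum.inl (α, inclA I)) i - w (Sum.inl (α, succA I i)))) _ w :=
    fun α I i => (hasFDerivAt_apply (𝕜 := ℝ) (Sum.inr (α, I, i)) w).mul
      ((hasFDerivAt_apply (𝕜 := ℝ) (Sum.inl (α, succA I i)) w).const_sub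
        (V (Sum.inl (α, inclA I)) i))
  have h3 := h1.add (HasFDerivAt.fun_sum (u := Finset.univ) fun α _ =>
    HasFDerivAt.fun_sum (u := Finset.univ) fun I _ =>
    HasFDerivAt.fun_sum (u := Finset.univ) fun i _ => h2 α I i)
  have h4 : HasFDerivAt (fun w => LExt L x w V) _ w := h3
  rw [h4.fderiv]
  simp only [ContinuousLinearMap.add_apply, ContinuousLinearMap.sum_apply,
    ContinuousLinearMap.comp_apply, ContinuousLinearMap.smul_apply,
    ContinuousLinearMap.neg_apply, ContinuousLinearMap.proj_apply, smul_eq_mul]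
  refine congrArg₂ (· + ·) rfl ?_
  refine Finset.sum_congr rfl fun α _ => Finset.sum_congr rfl fun I _ =>
    Finset.sum_congr rfl fun i _ => ?_
  ring

theorem aux_fderiv_v {n m k : ℕ} (L : (Fin n → ℝ) → (Fin m → Adx n k → ℝ) → ℝ)
    (x : Fin n → ℝ)
    (w : Sidx n m k → ℝ) (V d : Sidx n m k → Fin n → ℝ) :
    fderiv ℝ (fun v => LExt L x w v) V d
      = ∑ α : Fin m, ∑ I : Bdx n k, ∑ i : Fin n,
          w (Sum.inr (α, I, i)) * d (Sum.inl (α, inclA I)) i := by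
  have h2 : ∀ (α : Fin m) (I : Bdx n k) (i : Fin n),
      HasFDerivAt (fun v : Sidx n m k → Fin n → ℝ =>
      w (Sum.inr (α, I, i)) * (v (Sum.inl (α, inclA I)) i - w (Sum.inl (α, succA I i)))) _ V :=
    fun α I i => ((((ContinuousLinearMap.proj (R := ℝ) (φ := fun _ : Fin n => ℝ) i).comp
      (ContinuousLinearMap.proj (R := ℝ) (φ := fun _ : Sidx n m k => Fin n → ℝ)
        (Sum.inl (α, inclA I)))).hasFDerivAt (x := V)).sub_const
        (w (Sum.inl (α, succA I i)))).const_mul (w (Sum.inr (α, I, i)))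
  have h3 := (HasFDerivAt.fun_sum (u := Finset.univ) fun α _ =>
    HasFDerivAt.fun_sum (u := Finset.univ) fun I _ =>
    HasFDerivAt.fun_sum (u := Finset.univ) fun i _ => h2 α I i).const_add
      (L x (fun α I => w (Sum.inl (α, I))))
  have h4 : HasFDerivAt (fun v => LExt L x w v) _ V := h3
  rw [h4.fderiv]
  simp only [ContinuousLinearMap.sum_apply,
    ContinuousLinearMap.comp_apply, ContinuousLinearMap.smul_apply,
    ContinuousLinearMap.proj_apply, smul_eq_mul]

theorem aux_succ_eq {n k : ℕ} (I : Adx n k) (J : Bdx n k) (j : Fin n) :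
    succA J j = I ↔ ∃ h : 1 ≤ I.1 j, J = predB I j h := by
  constructor
  · rintro rfl
    refine ⟨by simp [succA], ?_⟩
    apply Subtype.ext
    funext l
    simp [succA, predB]
  · rintro ⟨h, rfl⟩
    apply Subtype.ext
    funext l
    by_cases hl : l = j
    · subst hl
      simp only [succA, predB, Pi.single_eq_same]
      omega
    · simp [succA, predB, Pi.single_eq_of_ne hl]

/-- The sum over momenta hitting `I`. -/
theorem aux_sum_succ {n m k : ℕ} (p : Fin m → Bdx n k → Fin n → ℝ) (α : Fin m) (I : Adx n k) :
    (∑ β : Fin m, ∑ J : Bdx n k, ∑ i : Fin n,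
      p β J i * (if β = α ∧ succA J i = I then (1 : ℝ) else 0))
      = ∑ j, if h : 1 ≤ I.1 j then p α (predB I j h) j else 0 := by
  rw [Finset.sum_eq_single α (fun β _ hb => by simp [hb]) (by simp)]
  rw [Finset.sum_comm]
  refine Finset.sum_congr rfl fun j _ => ?_
  split_ifs with h
  · rw [Finset.sum_eq_single (predB I j h)]
    · rw [if_pos ⟨rfl, (aux_succ_eq I _ j).2 ⟨h, rfl⟩⟩, mul_one]
    · intro J _ hJ
      rw [if_neg, mul_zero]
      rintro ⟨-, h'⟩
      obtain ⟨_, h''⟩ := (aux_succ_eq I _ j).1 h'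
      exact hJ h''
    · simp
  · refine Finset.sum_eq_zero fun J _ => ?_
    rw [if_neg, mul_zero]
    rintro ⟨-, h'⟩
    exact h ((aux_succ_eq I _ j).1 h').1

theorem aux_EL_inr {n m k : ℕ} (L : (Fin n → ℝ) → (Fin m → Adx n k → ℝ) → ℝ)
    (hL : ∀ x, Differentiable ℝ (L x))
    (u : Fin m → Adx n k → (Fin n → ℝ) → ℝ)
    (p : Fin m → Bdx n k → Fin n → (Fin n → ℝ) → ℝ)
    (α : Fin m) (I : Bdx n k) (i : Fin n) (x : Fin n → ℝ) :
    EL (LExt L) (jointFields u p) (Sum.inr (α, I, i)) x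
      = pd i (u α (inclA I)) x - u α (succA I i) x := by
  unfold EL
  simp only [aux_fderiv_w L x (hL x), aux_fderiv_v]
  have hz : (fun (β : Fin m) (J : Adx n k) =>
      (Pi.single (Sum.inr (α, I, i)) 1 : Sidx n m k → ℝ) (Sum.inl (β, J))) = 0 := by
    funext β J; simp
  have hz2 : ∀ (i' : Fin n) (β : Fin m) (J : Adx n k) (j : Fin n),
      (Pi.single (Sum.inr (α, I, i)) (Pi.single i' 1) : Sidx n m k → Fin n → ℝ)
        (Sum.inl (β, J)) j = 0 := by
    intros; simp
  have hz3 : ∀ (i' : Fin n), pd i' (fun _ : Fin n → ℝ => (0:ℝ)) x = 0 := by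
    intro i'; simp [pd]
  have hs : ∀ (β : Fin m) (J : Adx n k),
      (Pi.single (Sum.inr (α, I, i)) 1 : Sidx n m k → ℝ) (Sum.inl (β, J)) = 0 := by
    intros; simp
  simp only [hz2, mul_zero, Finset.sum_const_zero, hz3, sub_zero, hs]
  have : (fun (_ : Fin m) (_ : Adx n k) => (0:ℝ)) = 0 := rfl
  rw [this, map_zero, zero_add,
    Finset.sum_eq_single α (fun β _ hb => by simp [Pi.single_apply, hb]) (by simp),
    Finset.sum_eq_single I (fun β _ hb => by simp [Pi.single_apply, hb]) (by simp),
    Finset.sum_eq_single i (fun β _ hb => by simp [Pi.single_apply, hb]) (by simp),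
    Pi.single_eq_same, one_mul]
  rfl

theorem aux_EL_inl {n m k : ℕ} (L : (Fin n → ℝ) → (Fin m → Adx n k → ℝ) → ℝ)
    (hL : ∀ x, Differentiable ℝ (L x))
    (u : Fin m → Adx n k → (Fin n → ℝ) → ℝ)
    (p : Fin m → Bdx n k → Fin n → (Fin n → ℝ) → ℝ)
    (α : Fin m) (I : Adx n k) (x : Fin n → ℝ) :
    EL (LExt L) (jointFields u p) (Sum.inl (α, I)) x
      = dLdu L α I x (fun β J => u β J x)
        - (∑ j, if h : 1 ≤ I.1 j then p α (predB I j h) j x else 0)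
        - ∑ i, pd i (fun y => if h : (∑ l, I.1 l) + 1 ≤ k then p α ⟨I.1, h⟩ i y else 0) x := by
  unfold EL
  simp only [aux_fderiv_w L x (hL x), aux_fderiv_v]
  have hd : (fun (β : Fin m) (J : Adx n k) =>
      (Pi.single (Sum.inl (α, I)) 1 : Sidx n m k → ℝ) (Sum.inl (β, J)))
      = Pi.single α (Pi.single I 1) := by
    funext β J
    by_cases h : β = α
    · subst h
      simp [Pi.single_apply]
    · simp [Pi.single_apply, h]
  rw [hd]
  refine congrArg₂ (· - ·) ?_ ?_
  · rw [sub_eq_add_neg]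
    refine congrArg₂ (· + ·) rfl ?_
    rw [← aux_sum_succ (fun β J i => p β J i x) α I]
    simp only [← Finset.sum_neg_distrib]
    refine Finset.sum_congr rfl fun β _ => Finset.sum_congr rfl fun J _ =>
      Finset.sum_congr rfl fun i _ => ?_
    simp [Pi.single_apply, jointFields]
  · refine Finset.sum_congr rfl fun i _ => ?_
    refine congrFun (congrArg (pd i) ?_) x
    funext y
    rw [Finset.sum_eq_single α (fun β _ hb => by simp [Pi.single_apply, hb]) (by simp)]
    split_ifs with h
    · rw [Finset.sum_eq_single ⟨I.1, h⟩, Finset.sum_eq_single i]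
      · simp [inclA, jointFields]
      · intro j _ hj
        simp [inclA, Pi.single_apply, hj]
      · simp
      · intro J _ hJ
        have : inclA J ≠ I := fun h' => hJ (Subtype.ext (show (inclA J).1 = I.1 by rw [h']))
        simp [Pi.single_apply, this]
      · simp
    · refine Finset.sum_eq_zero fun J _ => Finset.sum_eq_zero fun j _ => ?_
      have : inclA J ≠ I := fun h' => h (by rw [← h']; exact J.2)
      simp [Pi.single_apply, this]

theorem EL_of_extended_iff_EulerLagrangeHamilton
    (n m k : ℕ) (hn : 1 ≤ n) (hm : 1 ≤ m) (hk : 2 ≤ k)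
    (L : (Fin n → ℝ) → (Fin m → Adx n k → ℝ) → ℝ)
    (hL : ContDiff ℝ (⊤ : ℕ∞)
      (fun z : (Fin n → ℝ) × (Fin m → Adx n k → ℝ) => L z.1 z.2))
    (u : Fin m → Adx n k → (Fin n → ℝ) → ℝ)
    (hu : ∀ α I, ContDiff ℝ (⊤ : ℕ∞) (u α I))
    (p : Fin m → Bdx n k → Fin n → (Fin n → ℝ) → ℝ)
    (hp : ∀ α I i, ContDiff ℝ (⊤ : ℕ∞) (p α I i)) :
    -- all Euler–Lagrange expressions of L₁ vanish identically ...
    (∀ (a : Sidx n m k) (x : Fin n → ℝ), EL (LExt L) (jointFields u p) a x = 0)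
      ↔
    -- ... iff (u, p) satisfies the Euler–Lagrange–Hamilton system of L:
    -- (i) the holonomy equations ∂_i u^α_I = u^α_{I+e_i}, |I| ≤ k−1
    ((∀ (α : Fin m) (I : Bdx n k) (i : Fin n) (x : Fin n → ℝ),
        pd i (u α (inclA I)) x = u α (succA I i) x) ∧
    -- (ii) Σ_i ∂_i p_α^{I,i} = ∂L/∂u^α_I − Σ_{j : I_j ≥ 1} p_α^{I−e_j,j}, |I| ≤ k−1
    (∀ (α : Fin m) (I : Bdx n k) (x : Fin n → ℝ),
        ∑ i, pd i (p α I i) x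
          = dLdu L α (inclA I) x (fun β J => u β J x)
            - ∑ j, if h : 1 ≤ I.1 j then p α (predB (inclA I) j h) j x else 0) ∧
    -- (iii) Σ_{j : I_j ≥ 1} p_α^{I−e_j,j} = ∂L/∂u^α_I, |I| = k
    (∀ (α : Fin m) (I : Adx n k), (∑ l, I.1 l) = k → ∀ x : Fin n → ℝ,
        (∑ j, if h : 1 ≤ I.1 j then p α (predB I j h) j x else 0)
          = dLdu L α I x (fun β J => u β J x))) := by
  have hLx : ∀ x, Differentiable ℝ (L x) := by
    intro x
    have h := hL.differentiable (by simp)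
    exact h.comp ((differentiable_const x).prodMk differentiable_id)
  constructor
  · intro h
    refine ⟨fun α I i x => ?_, fun α I x => ?_, fun α I hI x => ?_⟩
    · have := h (Sum.inr (α, I, i)) x
      rw [aux_EL_inr L hLx] at this
      linarith
    · have := h (Sum.inl (α, inclA I)) x
      rw [aux_EL_inl L hLx] at this
      have hI : (∑ l, (inclA I).1 l) + 1 ≤ k := I.2
      simp only [dif_pos hI] at this
      exact (sub_eq_zero.1 this).symm
    · have := h (Sum.inl (α, I)) x
      rw [aux_EL_inl L hLx] at this
      have hI' : ¬ (∑ l, I.1 l) + 1 ≤ k := by omega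
      simp only [dif_neg hI'] at this
      simp only [pd, fderiv_fun_const, Pi.zero_apply, zero_apply,
        ContinuousLinearMap.zero_apply, Finset.sum_const_zero, sub_zero] at this
      exact (sub_eq_zero.1 this).symm
  · rintro ⟨h1, h2, h3⟩ a x
    rcases a with ⟨α, I⟩ | ⟨α, I, i⟩
    · rw [aux_EL_inl L hLx]
      by_cases hI : (∑ l, I.1 l) + 1 ≤ k
      · simp only [dif_pos hI]
        exact sub_eq_zero.2 (h2 α ⟨I.1, hI⟩ x).symm
      · simp only [dif_neg hI]
        have := h3 α I (by have := I.2; omega) x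
        simp only [pd, fderiv_fun_const, Pi.zero_apply, zero_apply,
          ContinuousLinearMap.zero_apply, Finset.sum_const_zero, sub_zero]
        exact sub_eq_zero.2 this.symm
    · rw [aux_EL_inr L hLx, h1, sub_self]
end

section
/- (Theorem 3, coordinate form.) Define the de Donder–Weyl Hamiltonian H(x, (u^α_I)_{|I|≤k}, (p_α^{I,i})_{|I|≤k−1}) := Σ_{α} Σ_{|I|≤k−1} Σ_{i=1}^n p_α^{I,i} u^α_{I+e_i} − L(x, u). Then C^∞ fields u^α_I : ℝⁿ → ℝ (|I| ≤ k) and p_α^{I,i} : ℝⁿ → ℝ (|I| ≤ k−1) satisfy the de Donder–Weyl (PD-Hamilton) equations — namely, for all x: ∂_i u^α_I(x) = (∂H/∂p_α^{I,i})(x, u(x), p(x)) for all |I| ≤ k−1 and all i; Σ_{i=1}^n ∂_i p_α^{I,i}(x) = −(∂H/∂u^α_I)(x, u(x), p(x)) for all |I| ≤ k−1; and 0 = (∂H/∂u^α_I)(x, u(x), p(x)) for all |I| = k — if and only if they satisfy the Euler–Lagrange equations of the extended first-order Lagrangian L₁ (equivalently, the Euler–Lagrange–Hamilton system (i)–(iii)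 of L). -/
/-!
STATEMENT 6 (Theorem 3 of the paper, coordinate form): the de Donder–Weyl
(PD-Hamilton) equations of H = Σ p_α^{I,i} u^α_{I+e_i} − L and the
Euler–Lagrange equations of the extended first-order Lagrangian L₁ coincide.
-/

/-- The de Donder–Weyl Hamiltonian
`H(x, u, p) = Σ_{α,|I|≤k−1,i} p_α^{I,i} u^α_{I+e_i} − L(x, u)`. -/
noncomputable def Hddw {n m k : ℕ} (L : (Fin n → ℝ) → (Fin m → Adx n k → ℝ) → ℝ)
    (x : Fin n → ℝ) (u : Fin m → Adx n k → ℝ) (p : Fin m → Bdx n k → Fin n → ℝ) : ℝ :=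
  (∑ α : Fin m, ∑ I : Bdx n k, ∑ i : Fin n, p α I i * u α (succA I i)) - L x u

/-- The partial derivative ∂H/∂u^α_I. -/
noncomputable def dHdu {n m k : ℕ} (L : (Fin n → ℝ) → (Fin m → Adx n k → ℝ) → ℝ)
    (α : Fin m) (I : Adx n k) (x : Fin n → ℝ)
    (u : Fin m → Adx n k → ℝ) (p : Fin m → Bdx n k → Fin n → ℝ) : ℝ :=
  fderiv ℝ (fun w => Hddw L x w p) u (Pi.single α (Pi.single I 1))

/-- The partial derivative ∂H/∂p_α^{I,i}. -/
noncomputable def dHdp {n m k : ℕ} (L : (Fin n → ℝ) → (Fin m → Adx n k → ℝ) → ℝ)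
    (α : Fin m) (I : Bdx n k) (i : Fin n) (x : Fin n → ℝ)
    (u : Fin m → Adx n k → ℝ) (p : Fin m → Bdx n k → Fin n → ℝ) : ℝ :=
  fderiv ℝ (fun w => Hddw L x u w) p (Pi.single α (Pi.single I (Pi.single i 1)))

lemma fderiv_of_affine {E : Type*} [NormedAddCommGroup E] [NormedSpace ℝ E]
    {f : E → ℝ} {a v : E} {c : ℝ} (hf : DifferentiableAt ℝ f a)
    (h : ∀ t : ℝ, f (a + t • v) = f a + t * c) : fderiv ℝ f a v = c := by
  rw [← hf.lineDeriv_eq_fderiv, lineDeriv]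
  simp only [h]
  have : HasDerivAt (fun t : ℝ => f a + t * c) (1 * c) 0 :=
    ((hasDerivAt_id (0 : ℝ)).mul_const c).const_add (f a)
  simp [this.deriv]

lemma fderiv_of_neg {E F : Type*} [NormedAddCommGroup E] [NormedSpace ℝ E]
    [NormedAddCommGroup F] [NormedSpace ℝ F]
    {f : E → ℝ} {g : F → ℝ} {a v : E} {b w : F} {c : ℝ} (hf : DifferentiableAt ℝ f a)
    (hg : DifferentiableAt ℝ g b)
    (h : ∀ t : ℝ, f (a + t • v) = c - g (b + t • w)) : fderiv ℝ f a v = - fderiv ℝ g b w := by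
  rw [← hf.lineDeriv_eq_fderiv, ← hg.lineDeriv_eq_fderiv, lineDeriv, lineDeriv]
  simp only [h]
  rw [deriv_const_sub]

lemma inclA_inj {n k : ℕ} {I J : Bdx n k} : inclA I = inclA J ↔ I = J := by
  simp [inclA, Subtype.ext_iff]

section
variable {n m k : ℕ} (L : (Fin n → ℝ) → (Fin m → Adx n k → ℝ) → ℝ)
    (hL : ContDiff ℝ (⊤ : ℕ∞)
      (fun z : (Fin n → ℝ) × (Fin m → Adx n k → ℝ) => L z.1 z.2))
include hL

lemma L_diff (x : Fin n → ℝ) : Differentiable ℝ (L x) := by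
  have h := hL.differentiable (by simp)
  exact h.comp ((differentiable_const x).prodMk differentiable_id)

lemma H_diff_u (x : Fin n → ℝ) (p : Fin m → Bdx n k → Fin n → ℝ) :
    Differentiable ℝ (fun w => Hddw L x w p) := by
  have h := L_diff L hL x
  unfold Hddw
  fun_prop

omit hL in
lemma dHdp_eq (α : Fin m) (I : Bdx n k) (i : Fin n) (x : Fin n → ℝ)
    (u : Fin m → Adx n k → ℝ) (p : Fin m → Bdx n k → Fin n → ℝ) :
    dHdp L α I i x u p = u α (succA I i) := by
  unfold dHdp
  apply fderiv_of_affine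
  · unfold Hddw; fun_prop
  · intro t
    have : ∑ β : Fin m, ∑ J : Bdx n k, ∑ j : Fin n,
        (Pi.single α (Pi.single I (Pi.single i 1)) : Fin m → Bdx n k → Fin n → ℝ) β J j
          * u β (succA J j) = u α (succA I i) := by
      rw [Finset.sum_eq_single α, Finset.sum_eq_single I, Finset.sum_eq_single i] <;>
        simp +contextual
    rw [← this]
    simp only [Hddw, Pi.add_apply, Pi.smul_apply, smul_eq_mul, add_mul, Finset.sum_add_distrib,
      Finset.mul_sum, mul_assoc]
    ring

lemma LExt_diff_q (x : Fin n → ℝ) (v : Sidx n m k → Fin n → ℝ) :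
    Differentiable ℝ (fun w => LExt L x w v) := by
  have h := L_diff L hL x
  unfold LExt
  fun_prop

omit hL in
lemma LExt_diff_v (x : Fin n → ℝ) (q : Sidx n m k → ℝ) :
    Differentiable ℝ (fun v => LExt L x q v) := by
  unfold LExt
  fun_prop

lemma LExt_q_inr (α : Fin m) (I : Bdx n k) (i : Fin n) (x : Fin n → ℝ)
    (q : Sidx n m k → ℝ) (v : Sidx n m k → Fin n → ℝ) :
    fderiv ℝ (fun w => LExt L x w v) q (Pi.single (Sum.inr (α, I, i)) 1)
      = v (Sum.inl (α, inclA I)) i - q (Sum.inl (α, succA I i)) := by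
  apply fderiv_of_affine (LExt_diff_q L hL x v q)
  intro t
  have : ∑ β : Fin m, ∑ J : Bdx n k, ∑ j : Fin n,
      (Pi.single (Sum.inr (α, I, i)) 1 : Sidx n m k → ℝ) (Sum.inr (β, J, j))
        * (v (Sum.inl (β, inclA J)) j - q (Sum.inl (β, succA J j)))
        = v (Sum.inl (α, inclA I)) i - q (Sum.inl (α, succA I i)) := by
    rw [Finset.sum_eq_single α, Finset.sum_eq_single I, Finset.sum_eq_single i] <;>
      simp +contextual [Pi.single_apply]
  have h0 : ∀ c : Fin m × Adx n k,
      (Pi.single (Sum.inr (α, I, i)) 1 : Sidx n m k → ℝ) (Sum.inl c) = 0 := by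
    intro c; simp
  rw [← this]
  simp only [LExt, Pi.add_apply, Pi.smul_apply, smul_eq_mul, h0, mul_zero, add_zero, add_mul,
    Finset.sum_add_distrib, Finset.mul_sum, mul_assoc]
  ring

lemma LExt_q_inl (α : Fin m) (I : Adx n k) (x : Fin n → ℝ)
    (q : Sidx n m k → ℝ) (v : Sidx n m k → Fin n → ℝ) :
    fderiv ℝ (fun w => LExt L x w v) q (Pi.single (Sum.inl (α, I)) 1)
      = - dHdu L α I x (fun β J => q (Sum.inl (β, J))) (fun β J j => q (Sum.inr (β, J, j))) := by
  unfold dHdu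
  apply fderiv_of_neg (LExt_diff_q L hL x v q) (H_diff_u L hL x _ _)
    (c := ∑ β : Fin m, ∑ J : Bdx n k, ∑ j : Fin n,
      q (Sum.inr (β, J, j)) * v (Sum.inl (β, inclA J)) j)
  intro t
  have h0 : ∀ c : Fin m × Bdx n k × Fin n,
      (Pi.single (Sum.inl (α, I)) 1 : Sidx n m k → ℝ) (Sum.inr c) = 0 := by
    intro c; simp
  have h1 : ∀ β J, (Pi.single (Sum.inl (α, I)) 1 : Sidx n m k → ℝ) (Sum.inl (β, J)) =
      (Pi.single α (Pi.single I 1) : Fin m → Adx n k → ℝ) β J := by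
    intro β J
    by_cases hβ : β = α
    · subst hβ; simp [Pi.single_apply]
    · simp [Pi.single_apply, hβ]
  have h2 : (fun β J => (q + t • (Pi.single (Sum.inl (α, I)) 1 : Sidx n m k → ℝ)) (Sum.inl (β, J)))
      = (fun β J => q (Sum.inl (β, J))) + t • (Pi.single α (Pi.single I 1) : Fin m → Adx n k → ℝ) := by
    funext β J
    simp only [Pi.add_apply, Pi.smul_apply, h1]
  simp only [LExt, Hddw, h2]
  simp only [Pi.add_apply, Pi.smul_apply, smul_eq_mul, h0, h1, mul_zero, add_zero, mul_sub,
    Finset.sum_sub_distrib]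
  ring

omit hL in
lemma LExt_v (a : Sidx n m k) (i : Fin n) (x : Fin n → ℝ)
    (q : Sidx n m k → ℝ) (v : Sidx n m k → Fin n → ℝ) :
    fderiv ℝ (fun w => LExt L x q w) v (Pi.single a (Pi.single i 1))
      = ∑ β : Fin m, ∑ J : Bdx n k, ∑ j : Fin n, q (Sum.inr (β, J, j)) *
        (Pi.single a (Pi.single i 1) : Sidx n m k → Fin n → ℝ) (Sum.inl (β, inclA J)) j := by
  apply fderiv_of_affine (LExt_diff_v L x q v)
  intro t
  simp only [LExt, Pi.add_apply, Pi.smul_apply, smul_eq_mul, Finset.mul_sum, add_assoc]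
  congr 1
  simp only [← Finset.sum_add_distrib]
  refine Finset.sum_congr rfl fun β _ => Finset.sum_congr rfl fun J _ =>
    Finset.sum_congr rfl fun j _ => ?_
  ring

omit hL in
lemma LExt_v_inr (c : Fin m × Bdx n k × Fin n) (i : Fin n) (x : Fin n → ℝ)
    (q : Sidx n m k → ℝ) (v : Sidx n m k → Fin n → ℝ) :
    fderiv ℝ (fun w => LExt L x q w) v (Pi.single (Sum.inr c) (Pi.single i 1)) = 0 := by
  rw [LExt_v]; simp

omit hL in
lemma LExt_v_top (α : Fin m) (I : Adx n k) (hI : ∑ l, I.1 l = k) (i : Fin n) (x : Fin n → ℝ)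
    (q : Sidx n m k → ℝ) (v : Sidx n m k → Fin n → ℝ) :
    fderiv ℝ (fun w => LExt L x q w) v (Pi.single (Sum.inl (α, I)) (Pi.single i 1)) = 0 := by
  rw [LExt_v]
  refine Finset.sum_eq_zero fun β _ => Finset.sum_eq_zero fun J _ =>
    Finset.sum_eq_zero fun j _ => ?_
  rw [Pi.single_eq_of_ne]
  · simp
  · intro h
    have h3 : inclA J = I := by simpa using (Prod.ext_iff.1 (Sum.inl.inj h)).2
    have h4 := J.2
    rw [← h3] at hI
    simp only [inclA] at hI
    omega

omit hL in
lemma LExt_v_low (α : Fin m) (I : Bdx n k) (i : Fin n) (x : Fin n → ℝ)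
    (q : Sidx n m k → ℝ) (v : Sidx n m k → Fin n → ℝ) :
    fderiv ℝ (fun w => LExt L x q w) v (Pi.single (Sum.inl (α, inclA I)) (Pi.single i 1))
      = q (Sum.inr (α, I, i)) := by
  rw [LExt_v, Finset.sum_eq_single α, Finset.sum_eq_single I, Finset.sum_eq_single i]
  · simp
  · intro j _ hj; simp [hj]
  · simp
  · intro J _ hJ
    refine Finset.sum_eq_zero fun j _ => ?_
    rw [Pi.single_eq_of_ne]
    · simp
    · simpa [inclA_inj] using hJ
  · simp
  · intro β _ hβ
    refine Finset.sum_eq_zero fun J _ => Finset.sum_eq_zero fun j _ => ?_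
    rw [Pi.single_eq_of_ne]
    · simp
    · simp [hβ]
  · simp

variable (u : Fin m → Adx n k → (Fin n → ℝ) → ℝ) (p : Fin m → Bdx n k → Fin n → (Fin n → ℝ) → ℝ)

omit hL in
lemma pd_zero (i : Fin n) (x : Fin n → ℝ) : pd i (fun _ => 0) x = 0 := by
  simp [pd]

lemma EL_inr (α : Fin m) (I : Bdx n k) (i : Fin n) (x : Fin n → ℝ) :
    EL (LExt L) (jointFields u p) (Sum.inr (α, I, i)) x
      = pd i (u α (inclA I)) x - u α (succA I i) x := by
  unfold EL
  simp only [LExt_v_inr, LExt_q_inr L hL, pd_zero]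
  simp [jointFields]

lemma EL_top (α : Fin m) (I : Adx n k) (hI : ∑ l, I.1 l = k) (x : Fin n → ℝ) :
    EL (LExt L) (jointFields u p) (Sum.inl (α, I)) x
      = - dHdu L α I x (fun β J => u β J x) (fun β J j => p β J j x) := by
  unfold EL
  simp only [LExt_v_top L α I hI, LExt_q_inl L hL, pd_zero]
  simp [jointFields]

lemma EL_low (α : Fin m) (I : Bdx n k) (x : Fin n → ℝ) :
    EL (LExt L) (jointFields u p) (Sum.inl (α, inclA I)) x
      = - dHdu L α (inclA I) x (fun β J => u β J x) (fun β J j => p β J j x)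
        - ∑ i, pd i (p α I i) x := by
  unfold EL
  simp only [LExt_v_low, LExt_q_inl L hL]
  simp [jointFields]

end

theorem deDonderWeyl_iff_EL_of_extended
    (n m k : ℕ) (hn : 1 ≤ n) (hm : 1 ≤ m) (hk : 2 ≤ k)
    (L : (Fin n → ℝ) → (Fin m → Adx n k → ℝ) → ℝ)
    (hL : ContDiff ℝ (⊤ : ℕ∞)
      (fun z : (Fin n → ℝ) × (Fin m → Adx n k → ℝ) => L z.1 z.2))
    (u : Fin m → Adx n k → (Fin n → ℝ) → ℝ)
    (hu : ∀ α I, ContDiff ℝ (⊤ : ℕ∞) (u α I))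
    (p : Fin m → Bdx n k → Fin n → (Fin n → ℝ) → ℝ)
    (hp : ∀ α I i, ContDiff ℝ (⊤ : ℕ∞) (p α I i)) :
    -- the de Donder–Weyl (PD-Hamilton) equations:
    ((∀ (α : Fin m) (I : Bdx n k) (i : Fin n) (x : Fin n → ℝ),
        pd i (u α (inclA I)) x
          = dHdp L α I i x (fun β J => u β J x) (fun β J j => p β J j x)) ∧
    (∀ (α : Fin m) (I : Bdx n k) (x : Fin n → ℝ),
        ∑ i, pd i (p α I i) x
          = - dHdu L α (inclA I) x (fun β J => u β J x) (fun β J j => p β J j x)) ∧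
    (∀ (α : Fin m) (I : Adx n k), (∑ l, I.1 l) = k → ∀ x : Fin n → ℝ,
        0 = dHdu L α I x (fun β J => u β J x) (fun β J j => p β J j x)))
      ↔
    -- the Euler–Lagrange equations of the extended Lagrangian L₁:
    (∀ (a : Sidx n m k) (x : Fin n → ℝ), EL (LExt L) (jointFields u p) a x = 0) := by
  constructor
  · rintro ⟨h1, h2, h3⟩ a x
    rcases a with ⟨α, I⟩ | ⟨α, I, i⟩
    · by_cases hI : (∑ l, I.1 l) = k
      · rw [EL_top L hL u p α I hI, ← h3 α I hI x, neg_zero]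
      · have hI' : (∑ l, I.1 l) + 1 ≤ k := by
          have := I.2
          omega
        have h := EL_low L hL u p α ⟨I.1, hI'⟩ x
        rw [h2, sub_self] at h
        exact h
    · rw [EL_inr L hL, h1, dHdp_eq, sub_self]
  · intro h
    refine ⟨fun α I i x => ?_, fun α I x => ?_, fun α I hI x => ?_⟩
    · have := h (Sum.inr (α, I, i)) x
      rw [EL_inr L hL] at this
      rw [dHdp_eq]
      linarith
    · have := h (Sum.inl (α, inclA I)) x
      rw [EL_low L hL] at this
      linarith
    · have := h (Sum.inl (α, I)) x
      rw [EL_top L hL u p α I hI] at this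
      linarith
end

section
/- (Surjectivity of the covering: every solution of the higher-order Euler–Lagrange equations lifts.) Suppose s = (s^α) : ℝⁿ → ℝ^m is C^∞ and satisfies the k-th order Euler–Lagrange equations of L: for every α and every x ∈ ℝⁿ, Σ_{|I| ≤ k} (−1)^{|I|} ∂^I [ x ↦ (∂L/∂u^α_I)(x, (∂^J s^β(x))_{β,|J|≤k}) ](x) = 0. Then, setting u^α_I := ∂^I s^α for |I| ≤ k, there exist C^∞ momentum fields p_α^{I,i} : ℝⁿ → ℝ (α ≤ m, |I| ≤ k−1, 1 ≤ i ≤ n) such that (u, p) satisfies the Euler–Lagrange–Hamilton system of L: (i) ∂_i u^α_I = u^α_{I+e_i} for |I| ≤ k−1 and all i; (ii) Σ_i ∂_i p_α^{I,i}(x) = (∂L/∂u^α_I)(x, u(x)) − Σ_{j : I_j ≥ 1} p_α^{I−e_j, j}(x) for |I| ≤ k−1; (iii) Σ_{j : I_j ≥ 1} p_α^{I−e_j, j}(x) = (∂L/∂u^α_I)(x, u(x)) for |I| = k. -/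
/-- The iterated partial derivative ∂^I = ∂₁^{I₁} ⋯ ∂ₙ^{Iₙ} of `f : ℝⁿ → ℝ`,
for a multi-index `I : ℕⁿ`. -/
noncomputable def pdM {n : ℕ} (I : Fin n → ℕ) (f : (Fin n → ℝ) → ℝ) : (Fin n → ℝ) → ℝ :=
  (List.finRange n).foldr (fun i g => (pd i)^[I i] g) f

section Helpers
open Finset

lemma pd_smooth {n : ℕ} (i : Fin n) {f : (Fin n → ℝ) → ℝ} (hf : ContDiff ℝ (⊤ : ℕ∞) f) :
    ContDiff ℝ (⊤ : ℕ∞) (pd i f) := by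
  unfold pd
  exact (hf.fderiv_right (m := (⊤ : ℕ∞)) (by simp)).clm_apply contDiff_const

lemma pd_iter_smooth {n : ℕ} (i : Fin n) (a : ℕ) {f : (Fin n → ℝ) → ℝ}
    (hf : ContDiff ℝ (⊤ : ℕ∞) f) : ContDiff ℝ (⊤ : ℕ∞) ((pd i)^[a] f) := by
  induction a with
  | zero => simpa using hf
  | succ a ih => rw [Function.iterate_succ_apply']; exact pd_smooth i ih

lemma pd_comm {n : ℕ} (i j : Fin n) {f : (Fin n → ℝ) → ℝ} (hf : ContDiff ℝ (⊤ : ℕ∞) f) :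
    pd i (pd j f) = pd j (pd i f) := by
  have h1 : ContDiff ℝ (⊤ : ℕ∞) (fderiv ℝ f) := hf.fderiv_right (m := (⊤ : ℕ∞)) (by simp)
  have key : ∀ (a b : Fin n) (x : Fin n → ℝ),
      pd a (pd b f) x = fderiv ℝ (fderiv ℝ f) x (Pi.single a 1) (Pi.single b 1) := by
    intro a b x
    have hd : DifferentiableAt ℝ (fderiv ℝ f) x := (h1.differentiable (by simp)) x
    unfold pd
    rw [fderiv_clm_apply hd (differentiableAt_const _)]
    simp
  funext x
  rw [key, key]
  have hsymm : IsSymmSndFDerivAt ℝ f x := by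
    apply ContDiffAt.isSymmSndFDerivAt (n := (⊤ : ℕ∞)) hf.contDiffAt
    simp
    exact WithTop.coe_le_coe.2 (le_top : (2 : ℕ∞) ≤ ⊤)
  exact hsymm _ _

lemma pd_iter_comm {n : ℕ} (i j : Fin n) (a : ℕ) {f : (Fin n → ℝ) → ℝ}
    (hf : ContDiff ℝ (⊤ : ℕ∞) f) : pd i ((pd j)^[a] f) = (pd j)^[a] (pd i f) := by
  induction a with
  | zero => rfl
  | succ a ih =>
    rw [Function.iterate_succ_apply', Function.iterate_succ_apply',
      pd_comm i j (pd_iter_smooth j a hf), ih]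

lemma foldr_smooth {n : ℕ} (I : Fin n → ℕ) (l : List (Fin n)) {f : (Fin n → ℝ) → ℝ}
    (hf : ContDiff ℝ (⊤ : ℕ∞) f) :
    ContDiff ℝ (⊤ : ℕ∞) (l.foldr (fun i g => (pd i)^[I i] g) f) := by
  induction l with
  | nil => simpa using hf
  | cons a l ih => simp only [List.foldr_cons]; exact pd_iter_smooth _ _ ih

lemma pdM_smooth {n : ℕ} (I : Fin n → ℕ) {f : (Fin n → ℝ) → ℝ}
    (hf : ContDiff ℝ (⊤ : ℕ∞) f) : ContDiff ℝ (⊤ : ℕ∞) (pdM I f) := foldr_smooth I _ hf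

lemma foldr_notmem {n : ℕ} (I : Fin n → ℕ) (i : Fin n) (l : List (Fin n)) (h : i ∉ l)
    (f : (Fin n → ℝ) → ℝ) :
    l.foldr (fun j g => (pd j)^[(I + Pi.single i 1 : Fin n → ℕ) j] g) f
      = l.foldr (fun j g => (pd j)^[I j] g) f := by
  induction l with
  | nil => rfl
  | cons a l ih =>
    simp only [List.mem_cons, not_or] at h
    simp only [List.foldr_cons]
    rw [ih h.2]
    have : (I + Pi.single i 1 : Fin n → ℕ) a = I a := by simp [Pi.single_eq_of_ne (Ne.symm h.1)]
    rw [this]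

lemma pd_foldr_add {n : ℕ} (I : Fin n → ℕ) (i : Fin n) (l : List (Fin n)) (hl : l.Nodup)
    (h : i ∈ l) {f : (Fin n → ℝ) → ℝ} (hf : ContDiff ℝ (⊤ : ℕ∞) f) :
    pd i (l.foldr (fun j g => (pd j)^[I j] g) f)
      = l.foldr (fun j g => (pd j)^[(I + Pi.single i 1 : Fin n → ℕ) j] g) f := by
  induction l with
  | nil => simp at h
  | cons a l ih =>
    rw [List.nodup_cons] at hl
    simp only [List.foldr_cons]
    by_cases hia : i = a
    · subst hia
      rw [foldr_notmem I i l hl.1]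
      have : (I + Pi.single i 1 : Fin n → ℕ) i = I i + 1 := by simp
      rw [this, Function.iterate_succ_apply']
    · have hm : i ∈ l := by
        rcases List.mem_cons.1 h with h | h
        · exact absurd h hia
        · exact h
      rw [pd_iter_comm i a _ (foldr_smooth I l hf), ih hl.2 hm]
      have : (I + Pi.single i 1 : Fin n → ℕ) a = I a := by simp [Pi.single_eq_of_ne (Ne.symm hia)]
      rw [this]

lemma pd_foldr_comm {n : ℕ} (I : Fin n → ℕ) (i : Fin n) (l : List (Fin n))
    {f : (Fin n → ℝ) → ℝ} (hf : ContDiff ℝ (⊤ : ℕ∞) f) :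
    pd i (l.foldr (fun j g => (pd j)^[I j] g) f)
      = l.foldr (fun j g => (pd j)^[I j] g) (pd i f) := by
  induction l with
  | nil => rfl
  | cons a l ih =>
    simp only [List.foldr_cons]
    rw [pd_iter_comm i a _ (foldr_smooth I l hf), ih]

lemma pd_pdM {n : ℕ} (I : Fin n → ℕ) (i : Fin n) {f : (Fin n → ℝ) → ℝ}
    (hf : ContDiff ℝ (⊤ : ℕ∞) f) : pd i (pdM I f) = pdM (I + Pi.single i 1) f :=
  pd_foldr_add I i _ (List.nodup_finRange n) (List.mem_finRange i) hf

lemma pdM_pd {n : ℕ} (I : Fin n → ℕ) (i : Fin n) {f : (Fin n → ℝ) → ℝ}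
    (hf : ContDiff ℝ (⊤ : ℕ∞) f) : pdM I (pd i f) = pdM (I + Pi.single i 1) f := by
  rw [← pd_pdM I i hf]
  exact (pd_foldr_comm I i _ hf).symm

lemma pd_add {n : ℕ} (i : Fin n) {f g : (Fin n → ℝ) → ℝ} (hf : ContDiff ℝ (⊤ : ℕ∞) f)
    (hg : ContDiff ℝ (⊤ : ℕ∞) g) : pd i (f + g) = pd i f + pd i g := by
  funext x
  unfold pd
  rw [fderiv_add (hf.differentiable (by simp) x) (hg.differentiable (by simp) x)]
  rfl

lemma pd_smul {n : ℕ} (i : Fin n) (c : ℝ) {f : (Fin n → ℝ) → ℝ}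
    (hf : ContDiff ℝ (⊤ : ℕ∞) f) : pd i (c • f) = c • pd i f := by
  funext x
  unfold pd
  rw [fderiv_const_smul (hf.differentiable (by simp) x)]
  rfl

lemma pdM_add {n : ℕ} (I : Fin n → ℕ) {f g : (Fin n → ℝ) → ℝ} (hf : ContDiff ℝ (⊤ : ℕ∞) f)
    (hg : ContDiff ℝ (⊤ : ℕ∞) g) : pdM I (f + g) = pdM I f + pdM I g := by
  have it : ∀ (i : Fin n) (a : ℕ) {f g : (Fin n → ℝ) → ℝ}, ContDiff ℝ (⊤ : ℕ∞) f →
      ContDiff ℝ (⊤ : ℕ∞) g → (pd i)^[a] (f + g) = (pd i)^[a] f + (pd i)^[a] g := by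
    intro i a f g hf hg
    induction a with
    | zero => rfl
    | succ a ih =>
      simp only [Function.iterate_succ_apply']
      rw [ih, pd_add i (pd_iter_smooth i a hf) (pd_iter_smooth i a hg)]
  unfold pdM
  induction List.finRange n with
  | nil => rfl
  | cons a l ih =>
    simp only [List.foldr_cons]
    rw [ih, it a _ (foldr_smooth I l hf) (foldr_smooth I l hg)]

lemma pdM_smul {n : ℕ} (I : Fin n → ℕ) (c : ℝ) {f : (Fin n → ℝ) → ℝ}
    (hf : ContDiff ℝ (⊤ : ℕ∞) f) : pdM I (c • f) = c • pdM I f := by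
  have it : ∀ (i : Fin n) (a : ℕ) {f : (Fin n → ℝ) → ℝ}, ContDiff ℝ (⊤ : ℕ∞) f →
      (pd i)^[a] (c • f) = c • (pd i)^[a] f := by
    intro i a f hf
    induction a with
    | zero => rfl
    | succ a ih =>
      simp only [Function.iterate_succ_apply']
      rw [ih, pd_smul i c (pd_iter_smooth i a hf)]
  unfold pdM
  induction List.finRange n with
  | nil => rfl
  | cons a l ih =>
    simp only [List.foldr_cons]
    rw [ih, it a _ (foldr_smooth I l hf)]

lemma sum_smooth {n : ℕ} {ι : Type} (t : Finset ι) (F : ι → (Fin n → ℝ) → ℝ)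
    (hF : ∀ i, ContDiff ℝ (⊤ : ℕ∞) (F i)) : ContDiff ℝ (⊤ : ℕ∞) (∑ i ∈ t, F i) := by
  have : (∑ i ∈ t, F i) = fun x => ∑ i ∈ t, F i x := by funext x; simp
  rw [this]
  exact ContDiff.sum fun i _ => hF i

lemma pdM_sum {n : ℕ} {ι : Type} (I : Fin n → ℕ) (t : Finset ι) (F : ι → (Fin n → ℝ) → ℝ)
    (hF : ∀ i, ContDiff ℝ (⊤ : ℕ∞) (F i)) : pdM I (∑ i ∈ t, F i) = ∑ i ∈ t, pdM I (F i) := by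
  classical
  induction t using Finset.induction_on with
  | empty =>
    have h0 : ContDiff ℝ (⊤ : ℕ∞) (0 : (Fin n → ℝ) → ℝ) := contDiff_const
    have := pdM_smul I 0 h0
    simpa using this
  | insert a t ha ih =>
    rw [Finset.sum_insert ha, Finset.sum_insert ha, pdM_add I (hF a) (sum_smooth t F hF), ih]

/-- Downward recursion for the total momenta. -/
noncomputable def Taux {n : ℕ} (f : (Fin n → ℕ) → (Fin n → ℝ) → ℝ) :
    ℕ → (Fin n → ℕ) → (Fin n → ℝ) → ℝ
  | 0, I => f I
  | d + 1, I => f I + (-1 : ℝ) • ∑ i, (((I i : ℝ) + 1) / ((∑ l, I l : ℕ) + 1)) •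
      pd i (Taux f d (I + Pi.single i 1))

lemma Taux_smooth {n : ℕ} (f : (Fin n → ℕ) → (Fin n → ℝ) → ℝ)
    (hf : ∀ I, ContDiff ℝ (⊤ : ℕ∞) (f I)) (d : ℕ) :
    ∀ I, ContDiff ℝ (⊤ : ℕ∞) (Taux f d I) := by
  induction d with
  | zero => exact hf
  | succ d ih =>
    intro I
    unfold Taux
    exact (hf I).add (contDiff_const.smul
      (sum_smooth _ _ fun i => contDiff_const.smul (pd_smooth i (ih _))))

lemma reindex {n : ℕ} {V : Type} [AddCommGroup V] [Module ℝ V] (r : ℕ) (g : (Fin n → ℕ) → V) :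
    ∑ K ∈ piAntidiag (univ : Finset (Fin n)) r, ∑ i, (((K i : ℝ) + 1) / ((r : ℝ) + 1)) •
        g (K + Pi.single i 1)
      = ∑ M ∈ piAntidiag (univ : Finset (Fin n)) (r + 1), g M := by
  have h1 : ∀ M ∈ piAntidiag (univ : Finset (Fin n)) (r + 1),
      g M = ∑ i ∈ univ.filter (fun i => 1 ≤ M i), ((M i : ℝ) / ((r : ℝ) + 1)) • g M := by
    intro M hM
    rw [← Finset.sum_smul, Finset.sum_filter_of_ne, ← Finset.sum_div]
    · have : (∑ i, (M i : ℝ)) = r + 1 := by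
        have := (mem_piAntidiag.1 hM).1
        exact_mod_cast this
      rw [this, div_self (by positivity), one_smul]
    · intro i _ h
      by_contra h0
      have : M i = 0 := by omega
      simp [this] at h
  rw [Finset.sum_congr rfl h1, Finset.sum_sigma', Finset.sum_sigma']
  refine Finset.sum_bij' (fun a _ => ⟨a.1 + Pi.single a.2 1, a.2⟩)
    (fun a _ => ⟨a.1 - Pi.single a.2 1, a.2⟩) ?_ ?_ ?_ ?_ ?_
  · rintro ⟨K, i⟩ h
    simp only [mem_sigma, mem_piAntidiag, mem_univ, mem_filter] at h ⊢
    refine ⟨⟨?_, by simp⟩, by simp⟩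
    simp [Finset.sum_add_distrib, h.1.1]
  · rintro ⟨M, i⟩ h
    simp only [mem_sigma, mem_piAntidiag, mem_univ, mem_filter] at h ⊢
    refine ⟨⟨?_, by simp⟩, trivial⟩
    have hle : Pi.single i 1 ≤ M := by
      intro l
      by_cases hl : l = i
      · subst hl; simpa using h.2
      · simp [Pi.single_eq_of_ne hl]
    have e : M - Pi.single i 1 + Pi.single i 1 = M := tsub_add_cancel_of_le hle
    have e2 : ∑ l, (M - Pi.single i 1 + Pi.single i 1 : Fin n → ℕ) l = r + 1 := by rw [e]; exact h.1.1
    simp only [Pi.add_apply, Finset.sum_add_distrib, Finset.sum_pi_single', mem_univ, if_true] at e2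
    exact Nat.succ_injective e2
  · rintro ⟨K, i⟩ h
    simp
  · rintro ⟨M, i⟩ h
    simp only [mem_sigma, mem_piAntidiag, mem_univ, mem_filter] at h ⊢
    have hle : Pi.single i 1 ≤ M := by
      intro l
      by_cases hl : l = i
      · subst hl; simpa using h.2
      · simp [Pi.single_eq_of_ne hl]
    rw [tsub_add_cancel_of_le hle]
  · rintro ⟨K, i⟩ h
    simp

lemma Taux_sum {n : ℕ} (f : (Fin n → ℕ) → (Fin n → ℝ) → ℝ)
    (hf : ∀ I, ContDiff ℝ (⊤ : ℕ∞) (f I)) (k r : ℕ) (hr : r ≤ k) :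
    pdM 0 (Taux f k 0) = ∑ q ∈ range r, (-1 : ℝ) ^ q • ∑ K ∈ piAntidiag univ q, pdM K (f K)
      + (-1 : ℝ) ^ r • ∑ K ∈ piAntidiag univ r, pdM K (Taux f (k - r) K) := by
  induction r with
  | zero => simp
  | succ r ih =>
    rw [ih (by omega), Finset.sum_range_succ, add_assoc]
    congr 1
    obtain ⟨d, hd⟩ : ∃ d, k - r = d + 1 := ⟨k - r - 1, by omega⟩
    have hd' : k - (r + 1) = d := by omega
    rw [hd, hd']
    have step : ∀ K ∈ piAntidiag (univ : Finset (Fin n)) r, pdM K (Taux f (d + 1) K)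
        = pdM K (f K) + (-1 : ℝ) • ∑ i, (((K i : ℝ) + 1) / ((r : ℝ) + 1)) •
          (fun M => pdM M (Taux f d M)) (K + Pi.single i 1) := by
      intro K hK
      have hK' : ∑ l, K l = r := (mem_piAntidiag.1 hK).1
      have hsm := fun i => pd_smooth i (Taux_smooth f hf d (K + Pi.single i 1))
      have hsm2 : ∀ i, ContDiff ℝ (⊤ : ℕ∞) ((((K i : ℝ) + 1) / ((r : ℝ) + 1)) •
          pd i (Taux f d (K + Pi.single i 1))) := fun i => contDiff_const.smul (hsm i)
      have hsm3 : ContDiff ℝ (⊤ : ℕ∞) ((-1 : ℝ) • ∑ i, (((K i : ℝ) + 1) / ((r : ℝ) + 1)) •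
          pd i (Taux f d (K + Pi.single i 1))) := contDiff_const.smul (sum_smooth _ _ hsm2)
      rw [Taux, hK', pdM_add K (hf K) hsm3,
        pdM_smul K _ (sum_smooth _ _ hsm2), pdM_sum K _ _ hsm2]
      congr 2
      refine Finset.sum_congr rfl fun i _ => ?_
      rw [pdM_smul K _ (hsm i), pdM_pd K i (Taux_smooth f hf d _)]
    rw [Finset.sum_congr rfl step, Finset.sum_add_distrib, ← Finset.smul_sum,
      reindex r (fun M => pdM M (Taux f d M)),
      smul_add, smul_smul, pow_succ]

lemma sum_Adx {n k : ℕ} {V : Type} [AddCommMonoid V] (g : (Fin n → ℕ) → V) :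
    ∑ I : Adx n k, g I.1 = ∑ q ∈ range (k + 1), ∑ K ∈ piAntidiag univ q, g K := by
  rw [Finset.sum_sigma']
  refine Finset.sum_bij' (fun (I : Adx n k) _ => (⟨∑ l, I.1 l, I.1⟩ : Σ _ : ℕ, Fin n → ℕ))
    (fun a ha => ⟨a.2, by
      have h1 := mem_range.1 (mem_sigma.1 ha).1
      have h2 : ∑ j, a.2 j = a.1 := (mem_piAntidiag.1 (mem_sigma.1 ha).2).1
      omega⟩) ?_ ?_ ?_ ?_ ?_
  · intro I _
    have := I.2
    simp only [mem_sigma, mem_piAntidiag, mem_range]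
    exact ⟨by omega, by simp⟩
  · intro a _; exact mem_univ _
  · intro I _; rfl
  · rintro ⟨q, K⟩ ha
    simp only [mem_sigma, mem_piAntidiag, mem_range] at ha
    obtain ⟨_, h, _⟩ := ha
    subst h
    rfl
  · intro I _; rfl

lemma Taux_zero {n : ℕ} (f : (Fin n → ℕ) → (Fin n → ℝ) → ℝ)
    (hf : ∀ I, ContDiff ℝ (⊤ : ℕ∞) (f I)) (k : ℕ) :
    Taux f k 0 = ∑ I : Adx n k, (-1 : ℝ) ^ (∑ l, I.1 l) • pdM I.1 (f I.1) := by
  have h := Taux_sum f hf k k le_rfl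
  have h0 : ∀ g : (Fin n → ℝ) → ℝ, pdM 0 g = g := by
    intro g
    unfold pdM
    induction List.finRange n with
    | nil => rfl
    | cons a l ih => rw [List.foldr_cons, ih]; rfl
  rw [h0, Nat.sub_self] at h
  rw [h, sum_Adx (fun I => (-1 : ℝ) ^ (∑ l, I l) • pdM I (f I)), Finset.sum_range_succ]
  have e : ∀ q, (-1 : ℝ) ^ q • ∑ K ∈ piAntidiag (univ : Finset (Fin n)) q, pdM K (f K)
      = ∑ K ∈ piAntidiag (univ : Finset (Fin n)) q, (-1 : ℝ) ^ (∑ l, K l) • pdM K (f K) := by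
    intro q
    rw [Finset.smul_sum]
    refine Finset.sum_congr rfl fun K hK => ?_
    rw [(mem_piAntidiag.1 hK).1]
  simp only [Taux, e]

/-- The momenta. -/
noncomputable def pMom {n k : ℕ} (f : (Fin n → ℕ) → (Fin n → ℝ) → ℝ) (I : Bdx n k) (i : Fin n) :
    (Fin n → ℝ) → ℝ :=
  (((I.1 i : ℝ) + 1) / ((∑ l, I.1 l : ℕ) + 1)) •
    Taux f (k - ((∑ l, I.1 l) + 1)) (I.1 + Pi.single i 1)

lemma pMom_sum {n k : ℕ} (f : (Fin n → ℕ) → (Fin n → ℝ) → ℝ) (I : Adx n k)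
    (hI : 0 < ∑ l, I.1 l) (x : Fin n → ℝ) :
    (∑ j, if h : 1 ≤ I.1 j then pMom f (predB I j h) j x else 0)
      = Taux f (k - ∑ l, I.1 l) I.1 x := by
  have key : ∀ j, (if h : 1 ≤ I.1 j then pMom f (predB I j h) j x else 0)
      = ((I.1 j : ℝ) / (∑ l, I.1 l : ℕ)) * Taux f (k - ∑ l, I.1 l) I.1 x := by
    intro j
    split_ifs with h
    · have hle : Pi.single j 1 ≤ I.1 := by
        intro l
        by_cases hl : l = j
        · subst hl; simpa using h
        · simp [Pi.single_eq_of_ne hl]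
      have e1 : (predB I j h).1 + Pi.single j 1 = I.1 := tsub_add_cancel_of_le hle
      have e2 : (∑ l, (predB I j h).1 l) + 1 = ∑ l, I.1 l := by
        conv_rhs => rw [← e1]
        simp [Finset.sum_add_distrib]
      have e3 : (predB I j h).1 j + 1 = I.1 j := by
        conv_rhs => rw [← e1]
        simp
      unfold pMom
      rw [e1, e2, ← e3, ← e2]
      simp
    · have : I.1 j = 0 := by omega
      simp [this]
  rw [Finset.sum_congr rfl fun j _ => key j, ← Finset.sum_mul, ← Finset.sum_div]
  have h2 : (∑ i, (I.1 i : ℝ)) = (∑ l, I.1 l : ℕ) := by push_cast; rfl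
  rw [h2, div_self (by exact_mod_cast hI.ne'), one_mul]

end Helpers

/-!
STATEMENT 8 (surjectivity of the covering): every solution s of the k-th order
Euler–Lagrange equations of L lifts, via u := j_k s and a suitable choice of
smooth momentum fields p, to a solution (u, p) of the Euler–Lagrange–Hamilton
system of L.
-/

theorem higher_EulerLagrange_lifts_to_EulerLagrangeHamilton
    (n m k : ℕ) (hn : 1 ≤ n) (hm : 1 ≤ m) (hk : 2 ≤ k)
    (L : (Fin n → ℝ) → (Fin m → Adx n k → ℝ) → ℝ)
    (hL : ContDiff ℝ (⊤ : ℕ∞)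
      (fun z : (Fin n → ℝ) × (Fin m → Adx n k → ℝ) => L z.1 z.2))
    (s : Fin m → (Fin n → ℝ) → ℝ)
    (hs : ∀ α, ContDiff ℝ (⊤ : ℕ∞) (s α))
    -- s satisfies the k-th order Euler–Lagrange equations of L
    (hEL : ∀ (α : Fin m) (x : Fin n → ℝ),
        ∑ I : Adx n k, (-1 : ℝ) ^ (∑ l, I.1 l) *
          pdM I.1 (fun y => dLdu L α I y (fun β J => pdM J.1 (s β) y)) x = 0)
    -- u := j_k s, the k-jet prolongation of s
    (u : Fin m → Adx n k → (Fin n → ℝ) → ℝ)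
    (hjet : ∀ (α : Fin m) (I : Adx n k), u α I = pdM I.1 (s α)) :
    -- then there exist smooth momentum fields p such that (u, p) satisfies the
    -- Euler–Lagrange–Hamilton system of L:
    ∃ p : Fin m → Bdx n k → Fin n → (Fin n → ℝ) → ℝ,
      (∀ α I i, ContDiff ℝ (⊤ : ℕ∞) (p α I i)) ∧
      -- (i) the holonomy equations ∂_i u^α_I = u^α_{I+e_i}, |I| ≤ k−1
      (∀ (α : Fin m) (I : Bdx n k) (i : Fin n) (x : Fin n → ℝ),
          pd i (u α (inclA I)) x = u α (succA I i) x) ∧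
      -- (ii) Σ_i ∂_i p_α^{I,i} = ∂L/∂u^α_I − Σ_{j : I_j ≥ 1} p_α^{I−e_j,j}, |I| ≤ k−1
      (∀ (α : Fin m) (I : Bdx n k) (x : Fin n → ℝ),
          ∑ i, pd i (p α I i) x
            = dLdu L α (inclA I) x (fun β J => u β J x)
              - ∑ j, if h : 1 ≤ I.1 j then p α (predB (inclA I) j h) j x else 0) ∧
      -- (iii) Σ_{j : I_j ≥ 1} p_α^{I−e_j,j} = ∂L/∂u^α_I, |I| = k
      (∀ (α : Fin m) (I : Adx n k), (∑ l, I.1 l) = k → ∀ x : Fin n → ℝ,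
          (∑ j, if h : 1 ≤ I.1 j then p α (predB I j h) j x else 0)
            = dLdu L α I x (fun β J => u β J x)) := by
  classical
  have husm : ∀ α I, ContDiff ℝ (⊤ : ℕ∞) (u α I) := fun α I => by
    rw [hjet]; exact pdM_smooth _ (hs α)
  have hjs : ContDiff ℝ (⊤ : ℕ∞) (fun y => (fun β J => u β J y : Fin m → Adx n k → ℝ)) :=
    contDiff_pi.2 fun β => contDiff_pi.2 fun J => husm β J
  have hgs : ∀ α I, ContDiff ℝ (⊤ : ℕ∞) (fun y => dLdu L α I y (fun β J => u β J y)) := by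
    intro α I
    unfold dLdu
    exact (ContDiff.fderiv (f := L) (m := (⊤ : ℕ∞)) (n := (⊤ : ℕ∞)) hL hjs
      (by simp)).clm_apply contDiff_const
  let f : Fin m → (Fin n → ℕ) → (Fin n → ℝ) → ℝ := fun α I =>
    if h : (∑ j, I j) ≤ k then fun y => dLdu L α ⟨I, h⟩ y (fun β J => u β J y) else fun _ => 0
  have hf : ∀ α I, ContDiff ℝ (⊤ : ℕ∞) (f α I) := by
    intro α I
    by_cases h : (∑ j, I j) ≤ k
    · simp only [f, dif_pos h]; exact hgs α _
    · simp only [f, dif_neg h]; exact contDiff_const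
  have hfA : ∀ α (I : Adx n k), f α I.1 = fun y => dLdu L α I y (fun β J => u β J y) := by
    intro α I
    simp only [f, dif_pos I.2]
  have hT0 : ∀ α x, Taux (f α) k 0 x = 0 := by
    intro α x
    rw [Taux_zero (f α) (hf α) k, Finset.sum_apply, ← hEL α x]
    refine Finset.sum_congr rfl fun I _ => ?_
    rw [hfA]
    simp only [hjet, Pi.smul_apply, smul_eq_mul]
  refine ⟨fun α I i => pMom (f α) I i, ?_, ?_, ?_, ?_⟩
  · intro α I i
    exact contDiff_const.smul (Taux_smooth (f α) (hf α) _ _)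
  · intro α I i x
    rw [hjet, hjet, pd_pdM _ i (hs α)]
    rfl
  · intro α I x
    have hT : Taux (f α) (k - ∑ l, I.1 l) I.1 x = dLdu L α (inclA I) x (fun β J => u β J x)
        - ∑ i, pd i (pMom (f α) I i) x := by
      have hI := I.2
      obtain ⟨d, hd⟩ : ∃ d, k - ∑ l, I.1 l = d + 1 := ⟨k - (∑ l, I.1 l) - 1, by omega⟩
      have hd' : k - ((∑ l, I.1 l) + 1) = d := by omega
      have h1 : f α I.1 x = dLdu L α (inclA I) x (fun β J => u β J x) :=
        congrFun (hfA α (inclA I)) x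
      rw [hd, Taux, ← h1]
      simp only [pMom, hd', Pi.add_apply, Pi.smul_apply, Finset.sum_apply, smul_eq_mul]
      rw [neg_one_mul, ← sub_eq_add_neg]
      congr 1
      refine Finset.sum_congr rfl fun i _ => ?_
      rw [pd_smul i _ (Taux_smooth (f α) (hf α) _ _)]
      rfl
    have hP : (∑ j, if h : 1 ≤ I.1 j then pMom (f α) (predB (inclA I) j h) j x else 0)
        = Taux (f α) (k - ∑ l, I.1 l) I.1 x := by
      rcases Nat.eq_zero_or_pos (∑ l, I.1 l) with h0 | h0
      · have hz : I.1 = 0 := by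
          funext j
          exact (Finset.sum_eq_zero_iff.1 h0) j (Finset.mem_univ j)
        have hz2 : Taux (f α) (k - ∑ l, I.1 l) I.1 x = 0 := by
          rw [h0, hz, Nat.sub_zero, hT0]
        rw [hz2]
        refine Finset.sum_eq_zero fun j _ => ?_
        exact dif_neg (by rw [hz]; simp)
      · exact pMom_sum (f α) (inclA I) h0 x
    rw [hP, hT]
    ring
  · intro α I hI x
    rw [pMom_sum (f α) I (by omega) x, hI, Nat.sub_self, Taux, hfA]
end
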